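/- The map Φ: [0,∞) × [0,∞) → [0,∞) × ℝ defined by Φ(x,y) = (xy, x² − y²) is a homeomorphism. -/

import Mathlib

/-!
Statement 16: the change of coordinates `Φ(x, y) = (x y, x² − y²)` is a
homeomorphism `[0,∞) × [0,∞) → [0,∞) × ℝ` (used for the cell-like
stratification of gluing-parameter spaces of two-story holomorphic buildings).
-/

/-- The map `Φ : [0,∞) × [0,∞) → [0,∞) × ℝ`,
`Φ(x, y) = (x y, x² − y²)`, is a homeomorphism. -/
theorem statement_16 :
    IsHomeomorph (fun p : Set.Ici (0 : ℝ) × Set.Ici (0 : ℝ) =>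
      ((⟨(p.1 : ℝ) * (p.2 : ℝ),
          Set.mem_Ici.mpr (mul_nonneg (Set.mem_Ici.mp p.1.2) (Set.mem_Ici.mp p.2.2))⟩ :
            Set.Ici (0 : ℝ)),
        ((p.1 : ℝ) ^ 2 - (p.2 : ℝ) ^ 2))) := by
  refine isHomeomorph_iff_exists_inverse.mpr ⟨by fun_prop, fun q =>
    (⟨√((√(q.2 ^ 2 + 4 * (q.1 : ℝ) ^ 2) + q.2) / 2), Real.sqrt_nonneg _⟩,
      ⟨√((√(q.2 ^ 2 + 4 * (q.1 : ℝ) ^ 2) - q.2) / 2), Real.sqrt_nonneg _⟩), ?_, ?_, by fun_prop⟩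
  · rintro ⟨⟨x, hx⟩, ⟨y, hy⟩⟩
    have hx : 0 ≤ x := hx
    have hy : 0 ≤ y := hy
    have hr : √((x ^ 2 - y ^ 2) ^ 2 + 4 * (x * y) ^ 2) = x ^ 2 + y ^ 2 := by
      rw [show (x ^ 2 - y ^ 2) ^ 2 + 4 * (x * y) ^ 2 = (x ^ 2 + y ^ 2) ^ 2 by ring]
      exact Real.sqrt_sq (by positivity)
    refine Prod.ext (Subtype.ext ?_) (Subtype.ext ?_)
    · change √((√((x ^ 2 - y ^ 2) ^ 2 + 4 * (x * y) ^ 2) + (x ^ 2 - y ^ 2)) / 2) = x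
      rw [hr, show (x ^ 2 + y ^ 2 + (x ^ 2 - y ^ 2)) / 2 = x ^ 2 by ring, Real.sqrt_sq hx]
    · change √((√((x ^ 2 - y ^ 2) ^ 2 + 4 * (x * y) ^ 2) - (x ^ 2 - y ^ 2)) / 2) = y
      rw [hr, show (x ^ 2 + y ^ 2 - (x ^ 2 - y ^ 2)) / 2 = y ^ 2 by ring, Real.sqrt_sq hy]
  · rintro ⟨⟨a, ha⟩, b⟩
    have ha : 0 ≤ a := ha
    have hr : |b| ≤ √(b ^ 2 + 4 * a ^ 2) := Real.abs_le_sqrt (by nlinarith [sq_nonneg a])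
    have hr_sq : √(b ^ 2 + 4 * a ^ 2) ^ 2 = b ^ 2 + 4 * a ^ 2 := Real.sq_sqrt (by positivity)
    obtain ⟨hr_neg, hr_pos⟩ := abs_le.mp hr
    have hadd : 0 ≤ (√(b ^ 2 + 4 * a ^ 2) + b) / 2 := by linarith
    have hsub : 0 ≤ (√(b ^ 2 + 4 * a ^ 2) - b) / 2 := by linarith
    refine Prod.ext (Subtype.ext ?_) ?_
    · change √((√(b ^ 2 + 4 * a ^ 2) + b) / 2) * √((√(b ^ 2 + 4 * a ^ 2) - b) / 2) = a
      rw [← Real.sqrt_mul hadd, show (√(b ^ 2 + 4 * a ^ 2) + b) / 2 *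
        ((√(b ^ 2 + 4 * a ^ 2) - b) / 2) = a ^ 2 by linear_combination hr_sq / 4,
        Real.sqrt_sq ha]
    · change √((√(b ^ 2 + 4 * a ^ 2) + b) / 2) ^ 2 - √((√(b ^ 2 + 4 * a ^ 2) - b) / 2) ^ 2 = b
      rw [Real.sq_sqrt hadd, Real.sq_sqrt hsub]
      ring
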